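/- Let φ be a Gr(K_R)-formula in NNF and S a constraint system generated by the optimised algorithm starting from {x₀ ⊨ φ}. Then the length of any path in the induced graph G(S) is bounded by |φ|. -/

import Mathlib

/-! Core definitions for the graded modal logic Gr(K_R):
syntax, Kripke semantics, NNF, closure, constraint systems,
and the completion rules (optimised and standard). -/

namespace GrK

/-- Gr(K_R)-formulae over propositional atoms (ℕ) and relation names (ℕ).
`ge r n φ` is the counting modality ⟨R⟩_{≥n}φ and `le r n φ` is ⟨R⟩_{≤n}φ. -/
inductive GFormula : Type where
  | atom : ℕ → GFormula
  | neg  : GFormula → GFormula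
  | and  : GFormula → GFormula → GFormula
  | or   : GFormula → GFormula → GFormula
  | ge   : ℕ → ℕ → GFormula → GFormula
  | le   : ℕ → ℕ → GFormula → GFormula
  deriving DecidableEq

/-- A Kripke structure: a nonempty type of worlds, an accessibility relation
for each relation name, and a valuation. -/
structure Kripke where
  W : Type
  nonempty : Nonempty W
  rel : ℕ → W → W → Prop
  val : ℕ → Set W

/-- Satisfaction `M, x ⊨ φ`; the graded modalities count successors
(as a cardinal, to handle infinite structures faithfully). -/
def GFormula.sat (M : Kripke) : GFormula → M.W → Prop
  | .atom p, x => x ∈ M.val p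
  | .neg φ, x => ¬ GFormula.sat M φ x
  | .and φ ψ, x => GFormula.sat M φ x ∧ GFormula.sat M ψ x
  | .or φ ψ, x => GFormula.sat M φ x ∨ GFormula.sat M ψ x
  | .ge r n φ, x => (n : Cardinal) ≤ Cardinal.mk {y : M.W // M.rel r x y ∧ GFormula.sat M φ y}
  | .le r n φ, x => Cardinal.mk {y : M.W // M.rel r x y ∧ GFormula.sat M φ y} ≤ (n : Cardinal)

/-- ♯R^M(x,φ): the number of R-successors of x satisfying φ. -/
def Kripke.count (M : Kripke) (r : ℕ) (x : M.W) (φ : GFormula) : Cardinal :=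
  Cardinal.mk {y : M.W // M.rel r x y ∧ GFormula.sat M φ y}

/-- A formula is satisfiable iff it holds at some world of some Kripke structure. -/
def GFormula.satisfiable (φ : GFormula) : Prop :=
  ∃ (M : Kripke) (x : M.W), GFormula.sat M φ x

/-- Negation normal form: negation occurs only in front of atoms. -/
def GFormula.isNNF : GFormula → Prop
  | .atom _ => True
  | .neg (.atom _) => True
  | .neg _ => False
  | .and φ ψ => GFormula.isNNF φ ∧ GFormula.isNNF ψ
  | .or φ ψ => GFormula.isNNF φ ∧ GFormula.isNNF ψ
  | .ge _ _ φ => GFormula.isNNF φ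
  | .le _ _ φ => GFormula.isNNF φ

/-- ~φ : the NNF of the negation of an NNF formula. -/
def GFormula.nnfNeg : GFormula → GFormula
  | .atom p => .neg (.atom p)
  | .neg φ => φ
  | .and φ ψ => .or φ.nnfNeg ψ.nnfNeg
  | .or φ ψ => .and φ.nnfNeg ψ.nnfNeg
  | .ge r n φ => if n = 0 then .and (.atom 0) (.neg (.atom 0)) else .le r (n - 1) φ
  | .le r n φ => .ge r (n + 1) φ

/-- |φ| : the length of a formula. -/
def GFormula.size : GFormula → ℕ
  | .atom _ => 1
  | .neg φ => 1 + φ.size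
  | .and φ ψ => 1 + φ.size + ψ.size
  | .or φ ψ => 1 + φ.size + ψ.size
  | .ge _ _ φ => 1 + φ.size
  | .le _ _ φ => 1 + φ.size

/-- sub(φ) : the set of subformulae of φ. -/
def GFormula.sub : GFormula → Finset GFormula
  | .atom p => {.atom p}
  | .neg φ => insert (.neg φ) φ.sub
  | .and φ ψ => insert (.and φ ψ) (φ.sub ∪ ψ.sub)
  | .or φ ψ => insert (.or φ ψ) (φ.sub ∪ ψ.sub)
  | .ge r n φ => insert (.ge r n φ) φ.sub
  | .le r n φ => insert (.le r n φ) φ.sub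

/-- Membership in clos(φ): the smallest set containing φ, closed under
immediate subformulae of ∧, ∨ and the graded modalities, and closed under ~. -/
inductive InClos (φ : GFormula) : GFormula → Prop
  | base : InClos φ φ
  | andL {ψ₁ ψ₂} : InClos φ (.and ψ₁ ψ₂) → InClos φ ψ₁
  | andR {ψ₁ ψ₂} : InClos φ (.and ψ₁ ψ₂) → InClos φ ψ₂
  | orL {ψ₁ ψ₂} : InClos φ (.or ψ₁ ψ₂) → InClos φ ψ₁
  | orR {ψ₁ ψ₂} : InClos φ (.or ψ₁ ψ₂) → InClos φ ψ₂
  | ge {r n ψ} : InClos φ (.ge r n ψ) → InClos φ ψ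
  | le {r n ψ} : InClos φ (.le r n ψ) → InClos φ ψ
  | nnfNeg {ψ} : InClos φ ψ → InClos φ ψ.nnfNeg

/-- clos(φ) as a set of formulae. -/
def clos (φ : GFormula) : Set GFormula := {ψ | InClos φ ψ}

/-- A constraint: either `x ⊨ ψ` or `R x y`;
a constraint system (c.s.) is a finite set of constraints. -/
inductive Constraint : Type where
  | sat : ℕ → GFormula → Constraint
  | rel : ℕ → ℕ → ℕ → Constraint
  deriving DecidableEq

/-- The variables occurring in a constraint. -/
def Constraint.vars : Constraint → Finset ℕ
  | .sat x _ => {x}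
  | .rel _ x y => {x, y}

/-- ♯R^S(x,ψ): the number of variables y with {Rxy, y ⊨ ψ} ⊆ S. -/
noncomputable def countS (S : Finset Constraint) (r x : ℕ) (ψ : GFormula) : ℕ :=
  Set.ncard {y : ℕ | Constraint.rel r x y ∈ S ∧ Constraint.sat y ψ ∈ S}

/-- A clash: {x ⊨ p, x ⊨ ¬p} ⊆ S, or x ⊨ ⟨R⟩_{≤n}ψ ∈ S with ♯R^S(x,ψ) > n. -/
def hasClash (S : Finset Constraint) : Prop :=
  (∃ x p, Constraint.sat x (.atom p) ∈ S ∧ Constraint.sat x (.neg (.atom p)) ∈ S) ∨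
  (∃ x r n ψ, Constraint.sat x (.le r n ψ) ∈ S ∧ n < countS S r x ψ)

/-- `y` is a fresh variable w.r.t. S. -/
def freshIn (y : ℕ) (S : Finset Constraint) : Prop := ∀ c ∈ S, y ∉ c.vars

/-- The →∧-rule is applicable to a constraint for x in S. -/
def andApplicable (S : Finset Constraint) (x : ℕ) : Prop :=
  ∃ ψ₁ ψ₂, Constraint.sat x (.and ψ₁ ψ₂) ∈ S ∧
    ¬ (Constraint.sat x ψ₁ ∈ S ∧ Constraint.sat x ψ₂ ∈ S)

/-- The →∨-rule is applicable to a constraint for x in S. -/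
def orApplicable (S : Finset Constraint) (x : ℕ) : Prop :=
  ∃ ψ₁ ψ₂, Constraint.sat x (.or ψ₁ ψ₂) ∈ S ∧
    Constraint.sat x ψ₁ ∉ S ∧ Constraint.sat x ψ₂ ∉ S

/-- One application of the →∧-rule. -/
inductive StepAnd : Finset Constraint → Finset Constraint → Prop
  | mk (S : Finset Constraint) (x : ℕ) (ψ₁ ψ₂ : GFormula)
      (h : Constraint.sat x (.and ψ₁ ψ₂) ∈ S)
      (h2 : ¬ (Constraint.sat x ψ₁ ∈ S ∧ Constraint.sat x ψ₂ ∈ S)) :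
      StepAnd S (insert (Constraint.sat x ψ₁) (insert (Constraint.sat x ψ₂) S))

/-- One application of the →∨-rule. -/
inductive StepOr : Finset Constraint → Finset Constraint → Prop
  | mk (S : Finset Constraint) (x : ℕ) (ψ₁ ψ₂ χ : GFormula)
      (h : Constraint.sat x (.or ψ₁ ψ₂) ∈ S)
      (h1 : Constraint.sat x ψ₁ ∉ S) (h2 : Constraint.sat x ψ₂ ∉ S)
      (hχ : χ = ψ₁ ∨ χ = ψ₂) :
      StepOr S (insert (Constraint.sat x χ) S)

/-- One application of the optimised →≥-rule: if x ⊨ ⟨R⟩_{≥n}ψ ∈ S,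
♯R^S(x,ψ) < n and no →∧/→∨ rule applies to a constraint for x, add (for a
fresh y) the constraints Rxy, y ⊨ ψ, and y ⊨ χᵢ with χᵢ ∈ {ψᵢ, ~ψᵢ} for every
ψᵢ occurring in a graded constraint ⟨R⟩_{⋈m}ψᵢ for x with the same relation R. -/
inductive StepGe : Finset Constraint → Finset Constraint → Prop
  | mk (S S' : Finset Constraint) (x r n : ℕ) (ψ : GFormula) (y : ℕ)
      (f : GFormula → GFormula)
      (h : Constraint.sat x (.ge r n ψ) ∈ S)
      (hc : countS S r x ψ < n)
      (hna : ¬ andApplicable S x) (hno : ¬ orApplicable S x)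
      (hy : freshIn y S)
      (hf : ∀ ψ', f ψ' = ψ' ∨ f ψ' = ψ'.nnfNeg)
      (hS' : (S' : Set Constraint) = (S : Set Constraint) ∪
          {Constraint.rel r x y, Constraint.sat y ψ} ∪
          {c | ∃ ψ' m,
            (Constraint.sat x (.ge r m ψ') ∈ S ∨ Constraint.sat x (.le r m ψ') ∈ S) ∧
            c = Constraint.sat y (f ψ')}) :
      StepGe S S'

/-- One application of any optimised completion rule. -/
def OptStep (S S' : Finset Constraint) : Prop := StepAnd S S' ∨ StepOr S S' ∨ StepGe S S'

/-- The initial constraint system {x₀ ⊨ φ}. -/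
def initCS (x₀ : ℕ) (φ : GFormula) : Finset Constraint := {Constraint.sat x₀ φ}

/-- S is obtained from {x₀ ⊨ φ} by a sequence of optimised rule applications. -/
def OptReach (x₀ : ℕ) (φ : GFormula) (S : Finset Constraint) : Prop :=
  Relation.ReflTransGen OptStep (initCS x₀ φ) S

/-- A c.s. is complete iff no optimised rule is applicable. -/
def OptComplete (S : Finset Constraint) : Prop := ¬ ∃ S', OptStep S S'

/-- The edges of the graph G(S) induced by a c.s. S. -/
def edge (S : Finset Constraint) (x y : ℕ) : Prop := ∃ r, Constraint.rel r x y ∈ S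

/-- The variable x occurs in S (x is a node of G(S)). -/
def occursIn (x : ℕ) (S : Finset Constraint) : Prop := ∃ c ∈ S, x ∈ c.vars

/-- Satisfiability of a constraint system. -/
def csSat (S : Finset Constraint) : Prop :=
  ∃ (M : Kripke) (α : ℕ → M.W),
    (∀ r x y z, Constraint.rel r x y ∈ S → Constraint.rel r x z ∈ S → y ≠ z → α y ≠ α z) ∧
    (∀ x ψ, Constraint.sat x ψ ∈ S → GFormula.sat M ψ (α x)) ∧
    (∀ r x y, Constraint.rel r x y ∈ S → M.rel r (α x) (α y))

/-- The canonical structure M_S induced by a c.s. S (on the variables,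
with accessibility and valuation read off from S). -/
def canonical (S : Finset Constraint) : Kripke where
  W := ℕ
  nonempty := ⟨0⟩
  rel := fun r x y => Constraint.rel r x y ∈ S
  val := fun p => {x | Constraint.sat x (.atom p) ∈ S}

/-- Renaming a variable: `rename y z c` replaces y by z in the constraint c. -/
def Constraint.rename (y z : ℕ) : Constraint → Constraint
  | .sat x ψ => .sat (if x = y then z else x) ψ
  | .rel r a b => .rel r (if a = y then z else a) (if b = y then z else b)

/-- [z/y]S : replace every occurrence of y by z in S. -/
def renameCS (S : Finset Constraint) (y z : ℕ) : Finset Constraint :=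
  S.image (Constraint.rename y z)

/-- The replacement of y by z in S is safe. -/
def safeReplace (S : Finset Constraint) (y z : ℕ) : Prop :=
  ∀ x r n ψ, Constraint.sat x (.ge r n ψ) ∈ S → Constraint.rel r x y ∈ S →
    Constraint.rel r x z ∈ S → n ≤ countS (renameCS S y z) r x ψ

/-- One application of a standard (Hollunder–Baader) completion rule. -/
inductive StdStep : Finset Constraint → Finset Constraint → Prop
  | and (S : Finset Constraint) (x : ℕ) (ψ₁ ψ₂ : GFormula)
      (h : Constraint.sat x (.and ψ₁ ψ₂) ∈ S)
      (h2 : ¬ (Constraint.sat x ψ₁ ∈ S ∧ Constraint.sat x ψ₂ ∈ S)) :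
      StdStep S (insert (Constraint.sat x ψ₁) (insert (Constraint.sat x ψ₂) S))
  | or (S : Finset Constraint) (x : ℕ) (ψ₁ ψ₂ χ : GFormula)
      (h : Constraint.sat x (.or ψ₁ ψ₂) ∈ S)
      (h1 : Constraint.sat x ψ₁ ∉ S) (h2 : Constraint.sat x ψ₂ ∉ S)
      (hχ : χ = ψ₁ ∨ χ = ψ₂) :
      StdStep S (insert (Constraint.sat x χ) S)
  | choose (S : Finset Constraint) (x r n : ℕ) (ψ χ : GFormula) (y : ℕ)
      (h : Constraint.sat x (.ge r n ψ) ∈ S ∨ Constraint.sat x (.le r n ψ) ∈ S)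
      (hr : Constraint.rel r x y ∈ S)
      (h1 : Constraint.sat y ψ ∉ S) (h2 : Constraint.sat y ψ.nnfNeg ∉ S)
      (hχ : χ = ψ ∨ χ = ψ.nnfNeg) :
      StdStep S (insert (Constraint.sat y χ) S)
  | ge (S : Finset Constraint) (x r n : ℕ) (ψ : GFormula) (y : ℕ)
      (h : Constraint.sat x (.ge r n ψ) ∈ S)
      (hc : countS S r x ψ < n)
      (hy : freshIn y S) :
      StdStep S (insert (Constraint.rel r x y) (insert (Constraint.sat y ψ) S))
  | le (S : Finset Constraint) (x r n : ℕ) (ψ : GFormula) (y z : ℕ)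
      (h : Constraint.sat x (.le r n ψ) ∈ S)
      (hc : n < countS S r x ψ)
      (hyz : y ≠ z)
      (h1 : Constraint.rel r x y ∈ S) (h2 : Constraint.rel r x z ∈ S)
      (h3 : Constraint.sat y ψ ∈ S) (h4 : Constraint.sat z ψ ∈ S)
      (hsafe : safeReplace S y z) :
      StdStep S (renameCS S y z)

/-- S is obtained from {x₀ ⊨ φ} by a sequence of standard rule applications. -/
def StdReach (x₀ : ℕ) (φ : GFormula) (S : Finset Constraint) : Prop :=
  Relation.ReflTransGen StdStep (initCS x₀ φ) S

/-- A c.s. is complete (for the standard rules) iff no rule is applicable. -/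
def StdComplete (S : Finset Constraint) : Prop := ¬ ∃ S', StdStep S S'

end GrK

namespace GrK

/-- modal depth -/
def GFormula.md : GFormula → ℕ
  | .atom _ => 0
  | .neg φ => φ.md
  | .and φ ψ => max φ.md ψ.md
  | .or φ ψ => max φ.md ψ.md
  | .ge _ _ φ => 1 + φ.md
  | .le _ _ φ => 1 + φ.md

theorem GFormula.md_le_size (φ : GFormula) : φ.md ≤ φ.size := by
  induction φ <;> simp only [GFormula.md, GFormula.size] <;> omega

theorem GFormula.md_nnfNeg (φ : GFormula) : φ.nnfNeg.md ≤ φ.md := by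
  induction φ with
  | ge r n φ ih =>
    simp only [GFormula.nnfNeg]
    split_ifs <;> simp [GFormula.md]
  | _ => simp only [GFormula.md, GFormula.nnfNeg] <;> omega

/-- The invariant: a depth bound for every variable, decreasing along edges. -/
def Inv (N : ℕ) (S : Finset Constraint) : Prop :=
  ∃ d : ℕ → ℕ, (∀ x, d x ≤ N) ∧ (∀ x ψ, Constraint.sat x ψ ∈ S → ψ.md ≤ d x) ∧
    (∀ r x y, Constraint.rel r x y ∈ S → d y + 1 ≤ d x)

theorem Inv.step {N : ℕ} {S S' : Finset Constraint} (hI : Inv N S) (hs : OptStep S S') :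
    Inv N S' := by
  obtain ⟨d, h0, h1, h2⟩ := hI
  rcases hs with hs | hs | hs
  · obtain ⟨x, ψ₁, ψ₂, h, _⟩ := hs
    have hm := h1 _ _ h
    simp only [GFormula.md] at hm
    refine ⟨d, h0, ?_, ?_⟩
    · intro z χ hz
      simp only [Finset.mem_insert, Constraint.sat.injEq] at hz
      rcases hz with ⟨rfl, rfl⟩ | ⟨rfl, rfl⟩ | hz
      · omega
      · omega
      · exact h1 _ _ hz
    · intro r a b hz
      simp only [Finset.mem_insert, reduceCtorEq, false_or] at hz
      exact h2 _ _ _ hz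
  · obtain ⟨x, ψ₁, ψ₂, χ', h, _, _, hχ⟩ := hs
    have hm := h1 _ _ h
    simp only [GFormula.md] at hm
    refine ⟨d, h0, ?_, ?_⟩
    · intro z χ hz
      simp only [Finset.mem_insert, Constraint.sat.injEq] at hz
      rcases hz with ⟨rfl, rfl⟩ | hz
      · rcases hχ with rfl | rfl <;> omega
      · exact h1 _ _ hz
    · intro r a b hz
      simp only [Finset.mem_insert, reduceCtorEq, false_or] at hz
      exact h2 _ _ _ hz
  · obtain ⟨x, r, n, ψ, y, f, h, _, _, _, hy, hf, hS'⟩ := hs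
    have hmem : ∀ c, c ∈ S' ↔ _ := fun c => (Set.ext_iff.mp hS' c)
    have hm := h1 _ _ h
    simp only [GFormula.md] at hm
    have hxy : x ≠ y := by
      rintro rfl
      exact hy _ h (by simp [Constraint.vars])
    refine ⟨Function.update d y (d x - 1), ?_, ?_, ?_⟩
    · intro z
      have := h0 x
      have := h0 z
      by_cases hz : z = y
      · subst hz; simp only [Function.update_self]; omega
      · rw [Function.update_of_ne hz]; omega
    · intro z χ hz
      rw [hmem] at hz
      rcases hz with (hz | hz) | ⟨ψ', m, hψ', hc⟩
      · have hz : Constraint.sat z χ ∈ S := hz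
        have hzy : z ≠ y := by
          rintro rfl
          exact hy _ hz (by simp [Constraint.vars])
        rw [Function.update_of_ne hzy]
        exact h1 _ _ hz
      · simp only [Set.mem_insert_iff, Set.mem_singleton_iff, reduceCtorEq, false_or,
          Constraint.sat.injEq] at hz
        obtain ⟨rfl, rfl⟩ := hz
        simp only [Function.update_self]; omega
      · simp only [Constraint.sat.injEq] at hc
        obtain ⟨rfl, rfl⟩ := hc
        simp only [Function.update_self]
        have h3 : 1 + ψ'.md ≤ d x := by
          rcases hψ' with h' | h'
          · exact h1 _ _ h'
          · exact h1 _ _ h'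
        have h4 := GFormula.md_nnfNeg ψ'
        rcases hf ψ' with h' | h' <;> rw [h'] <;> omega
    · intro s a b hz
      rw [hmem] at hz
      rcases hz with (hz | hz) | ⟨ψ', m, hψ', hc⟩
      · have hz : Constraint.rel s a b ∈ S := hz
        have ha : a ≠ y := by
          rintro rfl
          exact hy _ hz (by simp [Constraint.vars])
        have hb : b ≠ y := by
          rintro rfl
          exact hy _ hz (by simp [Constraint.vars])
        rw [Function.update_of_ne ha, Function.update_of_ne hb]
        exact h2 _ _ _ hz
      · simp only [Set.mem_insert_iff, Set.mem_singleton_iff, reduceCtorEq, or_false,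
          Constraint.rel.injEq] at hz
        obtain ⟨rfl, rfl, rfl⟩ := hz
        rw [Function.update_self, Function.update_of_ne hxy]
        omega
      · simp at hc

theorem inv_of_reach {x₀ : ℕ} {φ : GFormula} {S : Finset Constraint}
    (h : OptReach x₀ φ S) : Inv φ.md S := by
  unfold OptReach at h
  induction h with
  | refl =>
    refine ⟨fun _ => φ.md, fun _ => le_rfl, ?_, ?_⟩
    · intro x ψ hx
      simp only [initCS, Finset.mem_singleton, Constraint.sat.injEq] at hx
      rw [hx.2]
    · intro r x y hx
      simp [initCS] at hx
  | tail _ hs ih => exact ih.step hs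

theorem chain_bound {S : Finset Constraint} {d : ℕ → ℕ}
    (h2 : ∀ r x y, Constraint.rel r x y ∈ S → d y + 1 ≤ d x) :
    ∀ (l : List ℕ) (x : ℕ), (x :: l).IsChain (edge S) → l.length ≤ d x := by
  intro l
  induction l with
  | nil => intro x _; simp
  | cons y l ih =>
    intro x hc
    rw [List.isChain_cons_cons] at hc
    obtain ⟨⟨r, hr⟩, hc⟩ := hc
    have := ih y hc
    have := h2 _ _ _ hr
    simp only [List.length_cons]
    omega

end GrK

open GrK in
/-- for a c.s. S generated by the optimised algorithm from
{x₀ ⊨ φ} (φ in NNF), the length of any path in G(S) is bounded by |φ|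
(a path with k edges visits k+1 nodes, so any chain of nodes has at most
|φ| + 1 elements). -/
theorem stmt_5 (φ : GFormula) (hNNF : φ.isNNF) (x₀ : ℕ) (S : Finset Constraint)
    (hreach : OptReach x₀ φ S) :
    ∀ l : List ℕ, l.Chain' (edge S) → l.length ≤ φ.size + 1 := by
  intro l hl
  obtain ⟨d, h0, _, h2⟩ := inv_of_reach hreach
  cases l with
  | nil => simp
  | cons x l =>
    have h3 := chain_bound h2 l x hl
    have h4 := h0 x
    have h5 := GFormula.md_le_size φ
    simp only [List.length_cons]
    omega
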